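/- arXiv:2510.08299 — 7 statements merged into one kernel-verified Lean document; each statement's English description precedes it below -/
import Mathlib

section
/- Let Δ : ℝ → ℝ be a continuously differentiable nonnegative function with Δ(0) = 0, let Δ* > 0, and suppose the set {t ≥ 0 : Δ(t) ≥ ε·Δ*} is nonempty for every ε > 0. Then the set of regular fidelity levels E := {ε > 0 : Δ′(τ(ε)) > 0}, where τ(ε) := sInf {t ≥ 0 : Δ(t) ≥ ε·Δ*}, is an open subset of ℝ. -/
open Filter Topology in
/-- A function with positive derivative at `x` exceeds its value at `x` immediately to the
right of `x`. -/
theorem eventually_nhdsGT_lt_of_deriv_pos {f : ℝ → ℝ} {x : ℝ} (h : 0 < deriv f x) :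
    ∀ᶠ t in 𝓝[>] x, f x < f t := by
  have hd : HasDerivAt f (deriv f x) x :=
    (differentiableAt_of_deriv_ne_zero h.ne').hasDerivAt
  have hs := (hasDerivAt_iff_tendsto_slope.1 hd).eventually (lt_mem_nhds h)
  filter_upwards [hs.filter_mono (nhdsWithin_mono x fun _ ht => ne_of_gt ht),
    self_mem_nhdsWithin] with t ht hxt
  rw [slope_def_field] at ht
  exact sub_pos.1 ((div_pos_iff_of_pos_right (sub_pos.2 hxt)).1 ht)

open Filter Topology in
/-- The first time a continuous function reaches a level depends continuously on the level
wherever the function has positive derivative at that time. -/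
theorem tendsto_sInf_hitting_of_deriv_pos {f : ℝ → ℝ} (hf : Continuous f) {c : ℝ}
    (hne : ∀ᶠ y in 𝓝 c, {t : ℝ | 0 ≤ t ∧ y ≤ f t}.Nonempty)
    (h : 0 < deriv f (sInf {t : ℝ | 0 ≤ t ∧ c ≤ f t})) :
    Tendsto (fun y => sInf {t : ℝ | 0 ≤ t ∧ y ≤ f t}) (𝓝 c)
      (𝓝 (sInf {t : ℝ | 0 ≤ t ∧ c ≤ f t})) := by
  have hbdd (y : ℝ) : BddBelow {t : ℝ | 0 ≤ t ∧ y ≤ f t} := ⟨0, fun _ ht => ht.1⟩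
  have hmem {y : ℝ} (hy : {t : ℝ | 0 ≤ t ∧ y ≤ f t}.Nonempty) :
      0 ≤ sInf {t : ℝ | 0 ≤ t ∧ y ≤ f t} ∧ y ≤ f (sInf {t : ℝ | 0 ≤ t ∧ y ≤ f t}) :=
    ((isClosed_le continuous_const continuous_id).inter
      (isClosed_le continuous_const hf)).csInf_mem hy (hbdd y)
  obtain ⟨hc0, hc⟩ := hmem hne.self_of_nhds
  refine tendsto_order.2 ⟨fun a ha => ?_, fun b hb => ?_⟩
  · rcases lt_or_ge a 0 with ha0 | ha0
    · filter_upwards [hne] with y hy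
      exact ha0.trans_le (hmem hy).1
    · obtain ⟨m, hm, hmax⟩ := isCompact_Icc.exists_isMaxOn (Set.nonempty_Icc.2 ha0)
        hf.continuousOn
      have hmc : f m < c := by
        by_contra! hle
        exact ((csInf_le (hbdd c) ⟨hm.1, hle⟩).trans hm.2).not_gt ha
      filter_upwards [hne, lt_mem_nhds hmc] with y hy hmy
      by_contra! hle
      exact ((hmem hy).2.trans (hmax ⟨(hmem hy).1, hle⟩)).not_gt hmy
  · obtain ⟨t, hft, ht, htb⟩ :=
      ((eventually_nhdsGT_lt_of_deriv_pos h).and (Ioo_mem_nhdsGT hb)).exists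
    filter_upwards [gt_mem_nhds (hc.trans_lt hft)] with y hy
    exact (csInf_le (hbdd y) ⟨hc0.trans ht.le, hy.le⟩).trans_lt htb

/-- For a continuously differentiable nonnegative `Δ` with `Δ 0 = 0` and
`Δ* > 0` with the threshold set nonempty for all `ε > 0`, the set of regular fidelity
levels `E := {ε > 0 : Δ′(τ ε) > 0}` is open in `ℝ`, where
`τ ε := sInf {t ≥ 0 : Δ t ≥ ε·Δ*}`. -/
theorem regular_fidelity_levels_isOpen
    (Δ : ℝ → ℝ) (hC1 : ContDiff ℝ 1 Δ) (hnonneg : ∀ t, 0 ≤ Δ t) (h0 : Δ 0 = 0)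
    (Δstar : ℝ) (hΔstar : 0 < Δstar)
    (hne : ∀ ε : ℝ, 0 < ε → {t : ℝ | 0 ≤ t ∧ ε * Δstar ≤ Δ t}.Nonempty)
    (τ : ℝ → ℝ) (hτ : ∀ ε : ℝ, τ ε = sInf {t : ℝ | 0 ≤ t ∧ ε * Δstar ≤ Δ t}) :
    IsOpen {ε : ℝ | 0 < ε ∧ 0 < deriv Δ (τ ε)} := by
  refine isOpen_iff_mem_nhds.2 fun ε ⟨hε, hd⟩ => ?_
  have hcont : ContinuousAt τ ε := by
    have hne' : ∀ᶠ y in nhds (ε * Δstar), {t : ℝ | 0 ≤ t ∧ y ≤ Δ t}.Nonempty := by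
      filter_upwards [lt_mem_nhds (mul_pos hε hΔstar)] with y hy
      simpa [div_mul_cancel₀ y hΔstar.ne'] using hne (y / Δstar) (div_pos hy hΔstar)
    rw [hτ] at hd
    have hmul : Filter.Tendsto (fun x => x * Δstar) (nhds ε) (nhds (ε * Δstar)) :=
      (continuous_mul_const Δstar).tendsto ε
    rw [funext hτ]
    exact (tendsto_sInf_hitting_of_deriv_pos hC1.continuous hne' hd).comp hmul
  have hderiv : ContinuousAt (fun x => deriv Δ (τ x)) ε :=
    (hC1.continuous_deriv le_rfl).continuousAt.comp hcont
  filter_upwards [lt_mem_nhds hε, hderiv.eventually (lt_mem_nhds hd)] with x hx hdx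
  exact ⟨hx, hdx⟩
end

section
/- Let Δ : ℝ → ℝ be a continuously differentiable nonnegative function with Δ(0) = 0, let Δ* > 0, and suppose the set {t ≥ 0 : Δ(t) ≥ ε·Δ*} is nonempty for every ε > 0. Then the set of non-regular fidelity levels {ε > 0 : Δ′(τ(ε)) = 0}, where τ(ε) := sInf {t ≥ 0 : Δ(t) ≥ ε·Δ*}, has Lebesgue measure zero (it is contained in the image (1/Δ*)·Δ({t ≥ 0 : Δ′(t) = 0}) of the critical set of Δ, which has measure zero by the Morse–Sard theorem for C¹ functions on ℝ). -/
open MeasureTheory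

/-- A continuous function attains a level exactly at the first nonnegative time it reaches it,
provided it starts at or below that level. -/
lemma apply_sInf_first_passage_eq {f : ℝ → ℝ} (hf : Continuous f) {c : ℝ} (h0 : f 0 ≤ c)
    (hne : {t : ℝ | 0 ≤ t ∧ c ≤ f t}.Nonempty) :
    f (sInf {t : ℝ | 0 ≤ t ∧ c ≤ f t}) = c := by
  have hclosed : IsClosed {t : ℝ | 0 ≤ t ∧ c ≤ f t} :=
    (isClosed_le continuous_const continuous_id).inter (isClosed_le continuous_const hf)
  have hbdd : BddBelow {t : ℝ | 0 ≤ t ∧ c ≤ f t} := ⟨0, fun t ht => ht.1⟩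
  obtain ⟨hnonneg, hle⟩ := hclosed.csInf_mem hne hbdd
  obtain ⟨s, hs, hfs⟩ := intermediate_value_Icc hnonneg hf.continuousOn ⟨h0, hle⟩
  have hs_eq : s = sInf {t : ℝ | 0 ≤ t ∧ c ≤ f t} :=
    le_antisymm hs.2 (csInf_le hbdd ⟨hs.1, hfs.ge⟩)
  rwa [← hs_eq]

/-- One-dimensional Sard theorem: the critical values of a differentiable real function form a
Lebesgue null set. -/
lemma volume_image_deriv_eq_zero {f : ℝ → ℝ} (hf : Differentiable ℝ f) :
    volume (f '' {t | deriv f t = 0}) = 0 := by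
  refine addHaar_image_eq_zero_of_det_fderivWithin_eq_zero volume
    (f' := fun t => ContinuousLinearMap.toSpanSingleton ℝ (deriv f t))
    (fun t _ => (hf t).hasDerivAt.hasFDerivAt.hasFDerivWithinAt) fun t ht => ?_
  rw [ContinuousLinearMap.det_toSpanSingleton]
  exact ht

/-- For a continuously differentiable nonnegative `Δ` with `Δ 0 = 0` and
`Δ* > 0` with the threshold set nonempty for all `ε > 0`, the set of non-regular
fidelity levels `{ε > 0 : Δ′(τ ε) = 0}` has Lebesgue measure zero, where
`τ ε := sInf {t ≥ 0 : Δ t ≥ ε·Δ*}`. -/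
theorem nonregular_fidelity_levels_measure_zero
    (Δ : ℝ → ℝ) (hC1 : ContDiff ℝ 1 Δ) (hnonneg : ∀ t, 0 ≤ Δ t) (h0 : Δ 0 = 0)
    (Δstar : ℝ) (hΔstar : 0 < Δstar)
    (hne : ∀ ε : ℝ, 0 < ε → {t : ℝ | 0 ≤ t ∧ ε * Δstar ≤ Δ t}.Nonempty)
    (τ : ℝ → ℝ) (hτ : ∀ ε : ℝ, τ ε = sInf {t : ℝ | 0 ≤ t ∧ ε * Δstar ≤ Δ t}) :
    volume {ε : ℝ | 0 < ε ∧ deriv Δ (τ ε) = 0} = 0 := by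
  have hdiff : Differentiable ℝ Δ := hC1.differentiable one_ne_zero
  refine measure_mono_null ?_ (volume_image_deriv_eq_zero (hdiff.div_const Δstar))
  rintro ε ⟨hε, hcrit⟩
  have hlevel : Δ (τ ε) = ε * Δstar := by
    rw [hτ]
    exact apply_sInf_first_passage_eq hC1.continuous (h0.trans_le (by positivity)) (hne ε hε)
  refine ⟨τ ε, ?_, ?_⟩
  · change deriv (fun t => Δ t / Δstar) (τ ε) = 0
    rw [deriv_div_const, hcrit, zero_div]
  · change Δ (τ ε) / Δstar = ε
    rw [hlevel, mul_div_cancel_right₀ _ hΔstar.ne']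
end

section
/- Let Δ : ℝ × ℝ^r → ℝ be twice continuously differentiable, nonnegative, with Δ(0, p) = 0 for all p, let Δ* > 0, and suppose for every p the set {t ≥ 0 : Δ(t, p) ≥ ε·Δ*} is nonempty for every ε > 0; define τ(ε, p) := sInf {t ≥ 0 : Δ(t, p) ≥ ε·Δ*}. Fix p₀ ∈ ℝ^r and ε > 0 with ∂ₜΔ(τ(ε, p₀), p₀) > 0. Then the map p ↦ τ(ε, p) is differentiable at p₀ and its gradient is ∂ₚτ(ε, p₀) = − ∂ₚΔ(T, p₀) / ∂ₜΔ(T, p₀), evaluated at T := τ(ε, p₀). -/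
open Filter Topology Set

/-- A continuous solution `g` of the implicit equation `f (x, g x) = const` is differentiable
wherever `f` is strictly differentiable with nonzero partial derivative in the last variable. -/
theorem hasFDerivAt_of_eventually_level_eq {E : Type*} [NormedAddCommGroup E] [NormedSpace ℝ E]
    [CompleteSpace E] {f : E × ℝ → ℝ} {f' : E × ℝ →L[ℝ] ℝ} {g : E → ℝ} {x₀ : E}
    (hf : HasStrictFDerivAt f f' (x₀, g x₀)) (hf' : f' (0, 1) ≠ 0) (hg : ContinuousAt g x₀)
    (hlevel : ∀ᶠ x in 𝓝 x₀, f (x, g x) = f (x₀, g x₀)) :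
    HasFDerivAt g (-(f' (0, 1))⁻¹ • f' ∘L .inl ℝ E ℝ) x₀ := by
  set a := f' (0, 1) with ha
  let e := ContinuousLinearEquiv.unitsEquivAut ℝ (Units.mk0 a hf')
  have he : (e : ℝ →L[ℝ] ℝ) = f' ∘L .inr ℝ E ℝ := by
    ext
    simp [e, ha]
  have hinv : (f' ∘L .inr ℝ E ℝ).IsInvertible := ⟨e, he⟩
  have hderiv := (hf.hasStrictFDerivAt_implicitFunctionOfProdDomain hinv).hasFDerivAt
  have heq : g =ᶠ[𝓝 x₀] hf.implicitFunctionOfProdDomain hinv := by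
    have htend : Tendsto (fun x => (x, g x)) (𝓝 x₀) (𝓝 (x₀, g x₀)) :=
      continuousAt_id.prodMk hg
    filter_upwards [hlevel, htend.eventually
      (hf.eventually_apply_eq_iff_implicitFunctionOfProdDomain hinv)] with x hx hiff
    exact (hiff.mp hx).symm
  refine (hderiv.congr_of_eventuallyEq heq).congr_fderiv ?_
  ext v
  rw [← he, ContinuousLinearMap.inverse_equiv]
  simp [e, mul_comm]

section FirstHittingTime

variable {E : Type*} [TopologicalSpace E] {f : ℝ → E → ℝ} {c : ℝ}

theorem sInf_superlevel_mem {u : ℝ → ℝ} (hu : Continuous u)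
    (hne : {t : ℝ | 0 ≤ t ∧ c ≤ u t}.Nonempty) :
    sInf {t : ℝ | 0 ≤ t ∧ c ≤ u t} ∈ {t : ℝ | 0 ≤ t ∧ c ≤ u t} :=
  ((isClosed_le continuous_const continuous_id).inter
    (isClosed_le continuous_const hu)).csInf_mem hne ⟨0, fun _ ht => ht.1⟩

theorem sInf_superlevel_le {u : ℝ → ℝ} {t : ℝ} (ht : 0 ≤ t) (hct : c ≤ u t) :
    sInf {t : ℝ | 0 ≤ t ∧ c ≤ u t} ≤ t :=
  csInf_le ⟨0, fun _ hs => hs.1⟩ ⟨ht, hct⟩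

theorem apply_sInf_superlevel {u : ℝ → ℝ} (hu : Continuous u) (h0 : u 0 ≤ c)
    (hne : {t : ℝ | 0 ≤ t ∧ c ≤ u t}.Nonempty) :
    u (sInf {t : ℝ | 0 ≤ t ∧ c ≤ u t}) = c := by
  obtain ⟨hT, hcT⟩ := sInf_superlevel_mem hu hne
  obtain ⟨t, ⟨ht0, htT⟩, ht⟩ := intermediate_value_Icc hT hu.continuousOn ⟨h0, hcT⟩
  rwa [← htT.antisymm (sInf_superlevel_le ht0 ht.ge)]

/-- The first hitting time of a level depends continuously on parameters where the level is
crossed with positive speed. -/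
theorem continuousAt_sInf_superlevel (hf : Continuous fun q : ℝ × E => f q.1 q.2)
    (hne : ∀ p, {t : ℝ | 0 ≤ t ∧ c ≤ f t p}.Nonempty) {p₀ : E}
    (h0 : f 0 p₀ ≤ c)
    (hreg : 0 < deriv (fun t => f t p₀) (sInf {t : ℝ | 0 ≤ t ∧ c ≤ f t p₀})) :
    ContinuousAt (fun p => sInf {t : ℝ | 0 ≤ t ∧ c ≤ f t p}) p₀ := by
  have hfp (p : E) : Continuous fun t => f t p := hf.comp (.prodMk continuous_id continuous_const)
  have hft (t : ℝ) : Continuous (f t) := hf.comp (.prodMk continuous_const continuous_id)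
  have hT0 := (sInf_superlevel_mem (hfp p₀) (hne p₀)).1
  have hTc := apply_sInf_superlevel (hfp p₀) h0 (hne p₀)
  refine tendsto_order.mpr ⟨fun a ha => ?_, fun b hb => ?_⟩
  · have hcompact : ∀ᶠ p in 𝓝 p₀, ∀ t ∈ Icc 0 a, f t p < c := by
      refine isCompact_Icc.eventually_forall_of_forall_eventually fun t ht => ?_
      have hlt : f t p₀ < c := by
        by_contra! hle
        exact ((sInf_superlevel_le ht.1 hle).trans ht.2).not_gt ha
      exact (hf.comp continuous_swap).continuousAt.eventually_lt_const hlt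
    filter_upwards [hcompact] with p hp
    have hmem := sInf_superlevel_mem (hfp p) (hne p)
    by_contra! hle
    exact (hp _ ⟨hmem.1, hle⟩).not_ge hmem.2
  · have hcross := eventually_nhdsWithin_sign_eq_of_deriv_pos (f := fun t => f t p₀ - c)
      (by simpa only [deriv_sub_const] using hreg) (sub_eq_zero.mpr hTc)
    obtain ⟨t, ht, hTt, htb⟩ :=
      ((hcross.filter_mono nhdsWithin_le_nhds).and (Ioo_mem_nhdsGT hb)).exists
    rw [sign_pos (sub_pos.mpr hTt), sign_eq_one_iff, sub_pos] at ht
    filter_upwards [(hft t).continuousAt.eventually_const_lt ht] with p hp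
    exact (sInf_superlevel_le (hT0.trans hTt.le) hp.le).trans_lt htb

end FirstHittingTime


/-- For a parameter-dependent twice continuously differentiable nonnegative
deviation functional `Δ(t, p)` vanishing at `t = 0`, with `Δ* > 0` and the threshold set
nonempty for all `ε > 0` and all `p`, if `ε > 0` is regular at `p₀` (i.e.
`∂ₜΔ(τ(ε,p₀), p₀) > 0`), then `p ↦ τ(ε, p)` is differentiable at `p₀` with gradient
`∂ₚτ(ε, p₀) = − ∂ₚΔ(T, p₀) / ∂ₜΔ(T, p₀)` at `T := τ(ε, p₀)`, where
`τ(ε,p) := sInf {t ≥ 0 : Δ(t,p) ≥ ε·Δ*}`. -/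
theorem decoherence_time_gradient_in_parameters
    {r : ℕ} (Δ : ℝ → (Fin r → ℝ) → ℝ)
    (hC2 : ContDiff ℝ 2 (fun q : ℝ × (Fin r → ℝ) => Δ q.1 q.2))
    (hnonneg : ∀ t p, 0 ≤ Δ t p) (h0 : ∀ p, Δ 0 p = 0)
    (Δstar : ℝ) (hΔstar : 0 < Δstar)
    (hne : ∀ (ε : ℝ) (p : Fin r → ℝ), 0 < ε → {t : ℝ | 0 ≤ t ∧ ε * Δstar ≤ Δ t p}.Nonempty)
    (τ : ℝ → (Fin r → ℝ) → ℝ)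
    (hτ : ∀ (ε : ℝ) (p : Fin r → ℝ), τ ε p = sInf {t : ℝ | 0 ≤ t ∧ ε * Δstar ≤ Δ t p})
    (p₀ : Fin r → ℝ) (ε : ℝ) (hε : 0 < ε)
    (hreg : 0 < deriv (fun t => Δ t p₀) (τ ε p₀)) :
    HasFDerivAt (fun p => τ ε p)
      (-(deriv (fun t => Δ t p₀) (τ ε p₀))⁻¹ •
        fderiv ℝ (fun p => Δ (τ ε p₀) p) p₀) p₀ := by
  have hF := hC2.continuous
  have hFp (p : Fin r → ℝ) : Continuous fun t => Δ t p :=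
    hF.comp (.prodMk continuous_id continuous_const)
  have hc : 0 < ε * Δstar := mul_pos hε hΔstar
  have h0c (p : Fin r → ℝ) : Δ 0 p ≤ ε * Δstar := (h0 p).trans_le hc.le
  have hlevel (p : Fin r → ℝ) : Δ (τ ε p) p = ε * Δstar := by
    rw [hτ]
    exact apply_sInf_superlevel (hFp p) (h0c p) (hne ε p hε)
  have hcont : ContinuousAt (fun p => τ ε p) p₀ := by
    rw [hτ] at hreg
    simp only [hτ]
    exact continuousAt_sInf_superlevel hF (fun p => hne ε p hε) (h0c p₀) hreg
  have hswap : ContDiff ℝ 2 fun q : (Fin r → ℝ) × ℝ => Δ q.2 q.1 :=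
    hC2.comp (contDiff_snd.prodMk contDiff_fst)
  have hstrict := hswap.contDiffAt.hasStrictFDerivAt (x := (p₀, τ ε p₀)) two_ne_zero
  have hdt : deriv (fun t => Δ t p₀) (τ ε p₀) =
      fderiv ℝ (fun q : (Fin r → ℝ) × ℝ => Δ q.2 q.1) (p₀, τ ε p₀) (0, 1) :=
    (hstrict.hasFDerivAt.comp_hasDerivAt (τ ε p₀)
      ((hasDerivAt_const (τ ε p₀) p₀).prodMk (hasDerivAt_id (τ ε p₀)))).deriv
  have hdp : fderiv ℝ (fun p => Δ (τ ε p₀) p) p₀ =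
      fderiv ℝ (fun q : (Fin r → ℝ) × ℝ => Δ q.2 q.1) (p₀, τ ε p₀) ∘L .inl ℝ _ ℝ :=
    (HasFDerivAt.comp (f := fun p => (p, τ ε p₀)) p₀ hstrict.hasFDerivAt
      (hasFDerivAt_prodMk_left p₀ (τ ε p₀))).fderiv
  rw [hdt] at hreg
  rw [hdt, hdp]
  exact hasFDerivAt_of_eventually_level_eq hstrict hreg.ne' hcont
    (.of_forall fun p => (hlevel p).trans (hlevel p₀).symm)
end

section
/- Let Δ : ℝ × ℝ^r → ℝ be twice continuously differentiable, nonnegative, with Δ(0, p) = 0 for all p, let Δ* > 0, and suppose for every p the set {t ≥ 0 : Δ(t, p) ≥ ε·Δ*} is nonempty for every ε > 0; define τ(ε, p) := sInf {t ≥ 0 : Δ(t, p) ≥ ε·Δ*} and E(p) := {ε > 0 : ∂ₜΔ(τ(ε, p), p) > 0}. Then the set-valued map p ↦ E(p) is lower semicontinuous: for every p₀ ∈ ℝ^r and every ε₀ ∈ E(p₀) there exist an open neighbourhood U of p₀ and an open neighbourhood N of ε₀ such that N ∩ (0, ∞) ⊆ E(p) for every p ∈ U. -/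
open Filter Topology

section HittingTime

variable {X : Type*} [TopologicalSpace X]

theorem bddBelow_hitting_set (g : ℝ → ℝ) (c : ℝ) : BddBelow {t : ℝ | 0 ≤ t ∧ c ≤ g t} :=
  ⟨0, fun _ ht => ht.1⟩

theorem eventually_lt_sInf_hitting {F : ℝ × X → ℝ} {c : X → ℝ} {x₀ : X} {s : ℝ}
    (hF : Continuous F) (hc : Continuous c)
    (hne : ∀ᶠ x in 𝓝 x₀, {t : ℝ | 0 ≤ t ∧ c x ≤ F (t, x)}.Nonempty)
    (hs : s < sInf {t : ℝ | 0 ≤ t ∧ c x₀ ≤ F (t, x₀)}) :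
    ∀ᶠ x in 𝓝 x₀, s < sInf {t : ℝ | 0 ≤ t ∧ c x ≤ F (t, x)} := by
  obtain ⟨u, hsu, hu⟩ := exists_between hs
  have hlt : ∀ᶠ x in 𝓝 x₀, ∀ t ∈ Set.Icc 0 u, F (t, x) < c x := by
    refine isCompact_Icc.eventually_forall_of_forall_eventually fun t ht => ?_
    have h : F (t, x₀) < c x₀ := by
      by_contra! h
      exact absurd (csInf_le (bddBelow_hitting_set (fun t => F (t, x₀)) _) ⟨ht.1, h⟩)
        (not_le.2 (ht.2.trans_lt hu))
    exact ContinuousAt.eventually_lt (f := fun z : X × ℝ => F (z.2, z.1))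
      (g := fun z : X × ℝ => c z.1) (by fun_prop) (by fun_prop) h
  filter_upwards [hlt, hne] with x hx hnex
  refine hsu.trans_le (le_csInf hnex fun t ht => ?_)
  by_contra! h
  exact absurd ht.2 (not_le.2 (hx t ⟨ht.1, h.le⟩))

theorem eventually_sInf_hitting_lt {F : ℝ × X → ℝ} {c : X → ℝ} {x₀ : X} {s : ℝ}
    (hF : Continuous F) (hc : Continuous c)
    (hne : {t : ℝ | 0 ≤ t ∧ c x₀ ≤ F (t, x₀)}.Nonempty)
    (hderiv : 0 < deriv (fun t => F (t, x₀)) (sInf {t : ℝ | 0 ≤ t ∧ c x₀ ≤ F (t, x₀)}))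
    (hs : sInf {t : ℝ | 0 ≤ t ∧ c x₀ ≤ F (t, x₀)} < s) :
    ∀ᶠ x in 𝓝 x₀, sInf {t : ℝ | 0 ≤ t ∧ c x ≤ F (t, x)} < s := by
  have hclosed : IsClosed {t : ℝ | 0 ≤ t ∧ c x₀ ≤ F (t, x₀)} :=
    isClosed_Ici.inter
      (isClosed_le continuous_const (hF.comp (continuous_id.prodMk continuous_const)))
  have hmem := hclosed.csInf_mem hne (bddBelow_hitting_set (fun t => F (t, x₀)) _)
  set t₀ := sInf {t : ℝ | 0 ≤ t ∧ c x₀ ≤ F (t, x₀)}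
  have hslope := hasDerivAt_iff_tendsto_slope.1
    (differentiableAt_of_deriv_ne_zero hderiv.ne').hasDerivAt
  have hpos := (hslope.eventually_const_lt hderiv).filter_mono
    (nhdsGT_le_nhdsNE t₀)
  obtain ⟨t, ht, ht₀, hts⟩ := (hpos.and (Ioo_mem_nhdsGT hs)).exists
  have hgt : c x₀ < F (t, x₀) := hmem.2.trans_lt ((slope_pos_iff_of_le ht₀.le).1 ht)
  filter_upwards [ContinuousAt.eventually_lt (f := c) (g := fun x => F (t, x))
    (by fun_prop) (by fun_prop) hgt] with x hx
  exact (csInf_le (bddBelow_hitting_set (fun t => F (t, x)) _)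
    ⟨hmem.1.trans ht₀.le, hx.le⟩).trans_lt hts

theorem continuousAt_sInf_hitting {F : ℝ × X → ℝ} {c : X → ℝ} {x₀ : X}
    (hF : Continuous F) (hc : Continuous c)
    (hne : ∀ᶠ x in 𝓝 x₀, {t : ℝ | 0 ≤ t ∧ c x ≤ F (t, x)}.Nonempty)
    (hderiv : 0 < deriv (fun t => F (t, x₀)) (sInf {t : ℝ | 0 ≤ t ∧ c x₀ ≤ F (t, x₀)})) :
    ContinuousAt (fun x => sInf {t : ℝ | 0 ≤ t ∧ c x ≤ F (t, x)}) x₀ :=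
  tendsto_order.2 ⟨fun _ => eventually_lt_sInf_hitting hF hc hne,
    fun _ => eventually_sInf_hitting_lt hF hc hne.self_of_nhds hderiv⟩

end HittingTime

theorem ContDiff.continuous_deriv_fst {P : Type*} [NormedAddCommGroup P] [NormedSpace ℝ P]
    {f : ℝ × P → ℝ} (hf : ContDiff ℝ 1 f) :
    Continuous fun q : ℝ × P => deriv (fun t => f (t, q.2)) q.1 := by
  have heq : (fun q : ℝ × P => deriv (fun t => f (t, q.2)) q.1) =
      fun q => fderiv ℝ f q (1, 0) := by
    funext q
    have hq : HasFDerivAt f (fderiv ℝ f q) (q.1, q.2) :=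
      (hf.differentiable one_ne_zero q).hasFDerivAt
    exact (hq.comp_hasDerivAt q.1 ((hasDerivAt_id q.1).prodMk (hasDerivAt_const q.1 q.2))).deriv
  rw [heq]
  exact (hf.continuous_fderiv one_ne_zero).clm_apply continuous_const

/-- For a parameter-dependent twice continuously differentiable nonnegative
deviation functional `Δ(t, p)` vanishing at `t = 0`, with `Δ* > 0` and the threshold set
nonempty, the set-valued map `p ↦ E(p) := {ε > 0 : ∂ₜΔ(τ(ε,p), p) > 0}` of regular
fidelity levels is lower semicontinuous: for every `p₀` and every `ε₀ ∈ E(p₀)` there are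
open neighbourhoods `U ∋ p₀` and `N ∋ ε₀` with `N ∩ (0,∞) ⊆ E(p)` for all `p ∈ U`. -/
theorem regular_fidelity_levels_lower_semicontinuous
    {r : ℕ} (Δ : ℝ → (Fin r → ℝ) → ℝ)
    (hC2 : ContDiff ℝ 2 (fun q : ℝ × (Fin r → ℝ) => Δ q.1 q.2))
    (hnonneg : ∀ t p, 0 ≤ Δ t p) (h0 : ∀ p, Δ 0 p = 0)
    (Δstar : ℝ) (hΔstar : 0 < Δstar)
    (hne : ∀ (ε : ℝ) (p : Fin r → ℝ), 0 < ε → {t : ℝ | 0 ≤ t ∧ ε * Δstar ≤ Δ t p}.Nonempty)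
    (τ : ℝ → (Fin r → ℝ) → ℝ)
    (hτ : ∀ (ε : ℝ) (p : Fin r → ℝ), τ ε p = sInf {t : ℝ | 0 ≤ t ∧ ε * Δstar ≤ Δ t p})
    (E : (Fin r → ℝ) → Set ℝ)
    (hE : ∀ p, E p = {ε : ℝ | 0 < ε ∧ 0 < deriv (fun t => Δ t p) (τ ε p)}) :
    ∀ (p₀ : Fin r → ℝ), ∀ ε₀ ∈ E p₀,
      ∃ U : Set (Fin r → ℝ), ∃ N : Set ℝ,
        IsOpen U ∧ p₀ ∈ U ∧ IsOpen N ∧ ε₀ ∈ N ∧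
        ∀ p ∈ U, N ∩ Set.Ioi (0 : ℝ) ⊆ E p := by
  intro p₀ ε₀ hε₀
  rw [hE] at hε₀
  obtain ⟨hε₀pos, hderiv⟩ := hε₀
  have hτcont : ContinuousAt (fun x : (Fin r → ℝ) × ℝ => τ x.2 x.1) (p₀, ε₀) := by
    simp only [hτ] at hderiv ⊢
    have hcont := hC2.continuous
    refine continuousAt_sInf_hitting (x₀ := (p₀, ε₀))
      (F := fun q : ℝ × ((Fin r → ℝ) × ℝ) => Δ q.1 q.2.1)
      (c := fun x : (Fin r → ℝ) × ℝ => x.2 * Δstar)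
      (hcont.comp (continuous_fst.prodMk (continuous_fst.comp continuous_snd)))
      (by fun_prop) ?_ hderiv
    filter_upwards [continuousAt_snd.eventually_const_lt hε₀pos] with x hx
    exact hne x.2 x.1 hx
  have hd := (hC2.of_le one_le_two).continuous_deriv_fst.continuousAt.comp
    (hτcont.prodMk continuousAt_fst)
  obtain ⟨U, N, hU, hp₀, hN, hεN, hsub⟩ :=
    mem_nhds_prod_iff'.1 (hd.eventually_const_lt hderiv)
  refine ⟨U, N, hU, hp₀, hN, hεN, fun p hp ε hε => ?_⟩
  rw [hE]
  exact ⟨hε.2, hsub (Set.mk_mem_prod hp hε.1)⟩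
end

section
/- Let Δ : ℝ × ℝ^r → ℝ be twice continuously differentiable, nonnegative, with Δ(0, p) = 0 for all p, let Δ* > 0, and suppose for every p the set {t ≥ 0 : Δ(t, p) ≥ ε·Δ*} is nonempty for every ε > 0; define τ(ε, p) := sInf {t ≥ 0 : Δ(t, p) ≥ ε·Δ*} and Δ_T(p) := max over t ∈ [0, T] of Δ(t, p). Fix ε > 0 and p₀ ∈ ℝ^r such that ∂ₜΔ(τ(ε, p₀), p₀) > 0, the gradient of p ↦ τ(ε, p) at p₀ vanishes, and its Hessian at p₀ is negative definite. Then, with T := τ(ε, p₀), the gradient of p ↦ Δ(T, p) at p₀ vanishes, its Hessian at p₀ is positive definite, and p₀ is a strict local minimiser of the function p ↦ Δ_T(p). -/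
open Matrix Filter Topology

theorem firstHit_spec {f : ℝ → ℝ} (hf : Continuous f) {c : ℝ} (h0 : f 0 < c)
    (hne : {t : ℝ | 0 ≤ t ∧ c ≤ f t}.Nonempty) :
    0 < sInf {t : ℝ | 0 ≤ t ∧ c ≤ f t} ∧ f (sInf {t : ℝ | 0 ≤ t ∧ c ≤ f t}) = c ∧
      ∀ t, 0 ≤ t → t < sInf {t : ℝ | 0 ≤ t ∧ c ≤ f t} → f t < c := by
  set S := {t : ℝ | 0 ≤ t ∧ c ≤ f t} with hS
  have hbdd : BddBelow S := ⟨0, fun t ht => ht.1⟩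
  have hclosed : IsClosed S :=
    (isClosed_le continuous_const continuous_id).inter (isClosed_le continuous_const hf)
  have hmem : sInf S ∈ S := hclosed.csInf_mem hne hbdd
  have hlt : ∀ t, 0 ≤ t → t < sInf S → f t < c := by
    intro t ht htS
    by_contra! h
    exact (csInf_le hbdd ⟨ht, h⟩).not_gt htS
  have hpos : 0 < sInf S := by
    refine hmem.1.lt_of_ne fun h => ?_
    have := hmem.2
    rw [← h] at this
    exact this.not_gt h0
  refine ⟨hpos, le_antisymm ?_ hmem.2, hlt⟩
  obtain ⟨t, ⟨ht0, htS⟩, hft⟩ := intermediate_value_Icc hpos.le hf.continuousOn ⟨h0.le, hmem.2⟩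
  have : t = sInf S := by
    refine htS.antisymm (csInf_le hbdd ⟨ht0, hft.ge⟩)
  rw [← this, hft]

theorem tendsto_firstHit {E : Type*} [TopologicalSpace E] {F : ℝ → E → ℝ}
    (hF : Continuous fun q : ℝ × E => F q.1 q.2) {c : ℝ} (h0 : ∀ p, F 0 p < c)
    (hne : ∀ p, {t : ℝ | 0 ≤ t ∧ c ≤ F t p}.Nonempty) {p₀ : E}
    (hreg : 0 < deriv (fun t => F t p₀) (sInf {t : ℝ | 0 ≤ t ∧ c ≤ F t p₀})) :
    Tendsto (fun p => sInf {t : ℝ | 0 ≤ t ∧ c ≤ F t p}) (𝓝 p₀)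
      (𝓝 (sInf {t : ℝ | 0 ≤ t ∧ c ≤ F t p₀})) := by
  have hFt : ∀ p, Continuous fun t => F t p := fun p =>
    hF.comp (Continuous.prodMk_left p)
  obtain ⟨hpos, heq, hlt⟩ := firstHit_spec (hFt p₀) (h0 p₀) (hne p₀)
  set T := sInf {t : ℝ | 0 ≤ t ∧ c ≤ F t p₀}
  rw [tendsto_order]
  constructor
  · intro a ha
    have key : ∀ᶠ p in 𝓝 p₀, ∀ t ∈ Set.Icc 0 a, F t p < c := by
      refine isCompact_Icc.eventually_forall_of_forall_eventually fun t ht => ?_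
      have hc : Continuous fun z : E × ℝ => F z.2 z.1 := hF.comp continuous_swap
      exact hc.continuousAt.eventually_lt_const (hlt t ht.1 (ht.2.trans_lt ha))
    filter_upwards [key] with p hp
    obtain ⟨hpos', heq', -⟩ := firstHit_spec (hFt p) (h0 p) (hne p)
    by_contra! h
    exact (hp _ ⟨hpos'.le, h⟩).ne heq'
  · intro b hb
    have hd := (differentiableAt_of_deriv_ne_zero hreg.ne').hasDerivAt
    have h1 : ∀ᶠ t in 𝓝[>] T, c < F t p₀ := by
      have := (hasDerivWithinAt_iff_tendsto_slope' (by simp)).1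
        (hd.hasDerivWithinAt (s := Set.Ioi T))
      filter_upwards [this.eventually (lt_mem_nhds hreg), self_mem_nhdsWithin] with t ht htT
      have := (slope_pos_iff_of_le (le_of_lt htT)).1 ht
      rwa [heq] at this
    obtain ⟨t, ht, htT, htb⟩ := (h1.and (Ioo_mem_nhdsGT hb)).exists
    have hc : Continuous fun p => F t p := hF.comp (Continuous.prodMk_right t)
    filter_upwards [hc.continuousAt.eventually_const_lt ht] with p hp
    have hbdd : BddBelow {t : ℝ | 0 ≤ t ∧ c ≤ F t p} := ⟨0, fun t ht => ht.1⟩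
    exact (csInf_le hbdd ⟨hpos.le.trans htT.le, hp.le⟩).trans_lt htb

theorem contDiffAt_of_implicit {E : Type*} [NormedAddCommGroup E] [NormedSpace ℝ E]
    [CompleteSpace E] {F : ℝ → E → ℝ} {n : WithTop ℕ∞} (hn : n ≠ 0)
    (hF : ContDiff ℝ n fun q : ℝ × E => F q.1 q.2) {g : E → ℝ} {p₀ : E} (hg : ContinuousAt g p₀)
    (heq : ∀ᶠ p in 𝓝 p₀, F (g p) p = F (g p₀) p₀)
    (hreg : deriv (fun t => F t p₀) (g p₀) ≠ 0) : ContDiffAt ℝ n g p₀ := by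
  set f : E × ℝ → ℝ := fun z => F z.2 z.1 with hf
  have hfC : ContDiff ℝ n f := hF.comp (contDiff_snd.prodMk contDiff_fst)
  have cdf : ContDiffAt ℝ n f (p₀, g p₀) := hfC.contDiffAt
  have hd : HasDerivAt (fun t => F t p₀) (fderiv ℝ f (p₀, g p₀) (0, 1)) (g p₀) := by
    have h1 : HasFDerivAt f (fderiv ℝ f (p₀, g p₀)) (p₀, g p₀) :=
      (cdf.differentiableAt hn).hasFDerivAt
    exact h1.comp_hasDerivAt (g p₀) ((hasDerivAt_const _ _).prodMk (hasDerivAt_id _))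
  rw [hd.deriv] at hreg
  have inv : (fderiv ℝ f (p₀, g p₀) ∘L .inr ℝ E ℝ).IsInvertible := by
    refine ⟨ContinuousLinearEquiv.unitsEquivAut ℝ (Units.mk0 _ hreg), ?_⟩
    ext
    simp
  refine (cdf.contDiffAt_implicitFunction hn inv).congr_of_eventuallyEq ?_
  have ht : Tendsto (fun p => (p, g p)) (𝓝 p₀) (𝓝 (p₀, g p₀)) :=
    continuousAt_id.prodMk hg
  filter_upwards [ht.eventually (cdf.eventually_apply_eq_iff_implicitFunction hn inv), heq]
    with p hp hpe
  exact (hp.1 hpe).symm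

theorem fderiv_levelSet_of_fderiv_eq_zero {E : Type*} [NormedAddCommGroup E] [NormedSpace ℝ E]
    {F : ℝ → E → ℝ} (hF : ContDiff ℝ 2 fun q : ℝ × E => F q.1 q.2) {g : E → ℝ} {p₀ : E}
    (hg : ContDiffAt ℝ 2 g p₀) {c : ℝ} (heq : ∀ᶠ p in 𝓝 p₀, F (g p) p = c)
    (hgrad : fderiv ℝ g p₀ = 0) :
    fderiv ℝ (fun p => F (g p₀) p) p₀ = 0 ∧ ∀ v w,
      fderiv ℝ (fun p => fderiv ℝ (fun p' => F (g p₀) p') p v) p₀ w =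
        -(deriv (fun t => F t p₀) (g p₀) * fderiv ℝ (fun p => fderiv ℝ g p v) p₀ w) := by
  set f : ℝ × E → ℝ := fun q => F q.1 q.2 with hf
  set A := fderiv ℝ f with hA
  have hfd : ∀ q, HasFDerivAt f (A q) q := fun q =>
    (hF.differentiable (by norm_num) q).hasFDerivAt
  have hAd : Differentiable ℝ A :=
    (hF.fderiv_right (m := 1) (by norm_num)).differentiable (by norm_num)
  have hgd : ∀ᶠ p in 𝓝 p₀, HasFDerivAt g (fderiv ℝ g p) p := by
    filter_upwards [hg.eventually (by simp)] with p hp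
    exact (hp.differentiableAt (by norm_num)).hasFDerivAt
  have hDg : DifferentiableAt ℝ (fderiv ℝ g) p₀ :=
    (hg.fderiv_right (m := 1) (by norm_num)).differentiableAt (by norm_num)
  have hslice : ∀ p, HasFDerivAt (fun p' => F (g p₀) p') (A (g p₀, p) ∘L .inr ℝ ℝ E) p := by
    intro p
    exact (hfd (g p₀, p)).comp p (hasFDerivAt_prodMk_right (g p₀) p)
  have hderiv : deriv (fun t => F t p₀) (g p₀) = A (g p₀, p₀) (1, 0) :=
    (HasFDerivAt.comp_hasDerivAt (f := fun t => (t, p₀)) (g p₀) (hfd (g p₀, p₀))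
      ((hasDerivAt_id (g p₀)).prodMk (hasDerivAt_const _ p₀))).deriv
  have key : ∀ᶠ p in 𝓝 p₀, ∀ v,
      A (g p, p) (0, v) = -(A (g p, p) (1, 0) * fderiv ℝ g p v) := by
    filter_upwards [hgd, heq.eventually_nhds] with p hp hpe v
    have h1 := HasFDerivAt.comp (f := fun p => (g p, p)) p (hfd (g p, p)) (hp.prodMk (hasFDerivAt_id p))
    have h2 : HasFDerivAt (fun p => F (g p) p) (0 : E →L[ℝ] ℝ) p :=
      (hasFDerivAt_const c p).congr_of_eventuallyEq hpe
    have h3 : A (g p, p) (fderiv ℝ g p v, v) = 0 := by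
      simpa using DFunLike.congr_fun (h1.unique h2) v
    have h4 : ((fderiv ℝ g p v, v) : ℝ × E) = fderiv ℝ g p v • ((1 : ℝ), (0 : E)) + (0, v) := by
      simp
    rw [h4, map_add, map_smul, smul_eq_mul] at h3
    linarith
  have hcurve : HasFDerivAt (fun p => (g p, p)) (.inr ℝ ℝ E) p₀ := by
    have := hgd.self_of_nhds.prodMk (hasFDerivAt_id p₀)
    rw [hgrad] at this
    exact this
  refine ⟨?_, fun v w => ?_⟩
  · rw [(hslice p₀).fderiv]
    ext v
    simp [key.self_of_nhds v, hgrad]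
  · have e1 : (fun p => fderiv ℝ (fun p' => F (g p₀) p') p v) = fun p => A (g p₀, p) (0, v) := by
      funext p
      rw [(hslice p).fderiv]
      simp
    have hB : HasFDerivAt (fun p => A (g p₀, p)) (fderiv ℝ A (g p₀, p₀) ∘L .inr ℝ ℝ E) p₀ :=
      (hAd (g p₀, p₀)).hasFDerivAt.comp p₀ (hasFDerivAt_prodMk_right (g p₀) p₀)
    have hB' : HasFDerivAt (fun p => A (g p, p)) (fderiv ℝ A (g p₀, p₀) ∘L .inr ℝ ℝ E) p₀ :=
      HasFDerivAt.comp (f := fun p => (g p, p)) p₀ (hAd (g p₀, p₀)).hasFDerivAt hcurve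
    have hv := hDg.hasFDerivAt.clm_apply (hasFDerivAt_const v p₀)
    have e2 : fderiv ℝ (fun p => A (g p₀, p) (0, v)) p₀ =
        fderiv ℝ (fun p => A (g p, p) (0, v)) p₀ :=
      (hB.clm_apply (hasFDerivAt_const ((0 : ℝ), v) p₀)).fderiv.trans
        (hB'.clm_apply (hasFDerivAt_const ((0 : ℝ), v) p₀)).fderiv.symm
    have e3 : (fun p => A (g p, p) (0, v)) =ᶠ[𝓝 p₀]
        fun p => -(A (g p, p) (1, 0) * fderiv ℝ g p v) := key.mono fun p hp => hp v
    have h5 : HasFDerivAt (fun p => -(A (g p, p) (1, 0) * fderiv ℝ g p v)) _ p₀ :=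
      ((hB'.clm_apply (hasFDerivAt_const ((1 : ℝ), (0 : E)) p₀)).mul hv).neg
    rw [e1, e2, e3.fderiv_eq, h5.fderiv, hv.fderiv, hderiv]
    simp [hgrad]

theorem eventually_lt_of_hessian_pos {E : Type*} [NormedAddCommGroup E] [NormedSpace ℝ E]
    [FiniteDimensional ℝ E] {h : E → ℝ} {p₀ : E} (hd : ∀ᶠ p in 𝓝 p₀, DifferentiableAt ℝ h p)
    (hd2 : DifferentiableAt ℝ (fderiv ℝ h) p₀) (hgrad : fderiv ℝ h p₀ = 0)
    (hpos : ∀ v, v ≠ 0 → 0 < fderiv ℝ (fderiv ℝ h) p₀ v v) :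
    ∀ᶠ p in 𝓝 p₀, p ≠ p₀ → h p₀ < h p := by
  set H := fderiv ℝ (fderiv ℝ h) p₀ with hH
  obtain ⟨m, hm, hmv⟩ : ∃ m > 0, ∀ v, m * ‖v‖ ^ 2 ≤ H v v := by
    rcases subsingleton_or_nontrivial E with hE | hE
    · exact ⟨1, one_pos, fun v => by simp [Subsingleton.elim v 0]⟩
    · have hne : (Metric.sphere (0 : E) 1).Nonempty := NormedSpace.sphere_nonempty.2 zero_le_one
      obtain ⟨u, hu, hmin⟩ := (isCompact_sphere (0 : E) 1).exists_isMinOn hne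
        (f := fun v => H v v) (by fun_prop)
      have hu0 : u ≠ 0 := by
        rintro rfl
        simp at hu
      refine ⟨H u u, hpos u hu0, fun v => ?_⟩
      rcases eq_or_ne v 0 with rfl | hv
      · simp
      have hv' : ‖v‖ ≠ 0 := norm_ne_zero_iff.2 hv
      have h1 : H u u ≤ H (‖v‖⁻¹ • v) (‖v‖⁻¹ • v) :=
        hmin (show ‖v‖⁻¹ • v ∈ Metric.sphere (0 : E) 1 by simp [norm_smul, hv'])
      have h2 : H (‖v‖⁻¹ • v) (‖v‖⁻¹ • v) * ‖v‖ ^ 2 = H v v := by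
        simp only [map_smul, FunLike.coe_smul, Pi.smul_apply, smul_eq_mul]
        field_simp
      rw [← h2]
      gcongr
  have hlin := hd2.hasFDerivAt.isLittleO.def (half_pos hm)
  obtain ⟨δ, hδ, hball⟩ := Metric.eventually_nhds_iff.1 (hd.and hlin)
  have hgradpos : ∀ q, dist q p₀ < δ → q ≠ p₀ → 0 < fderiv ℝ h q (q - p₀) := by
    intro q hq hne
    have h1 := (hball hq).2
    rw [hgrad, sub_zero] at h1
    have h2 := ContinuousLinearMap.le_of_opNorm_le _ h1 (q - p₀)
    have h3 := hmv (q - p₀)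
    have h4 : 0 < ‖q - p₀‖ := norm_pos_iff.2 (sub_ne_zero.2 hne)
    rw [Real.norm_eq_abs, FunLike.coe_sub, Pi.sub_apply] at h2
    have h5 := (abs_le.1 h2).1
    nlinarith [mul_pos hm (pow_pos h4 2)]
  refine Metric.eventually_nhds_iff.2 ⟨δ, hδ, fun {p} hp hne => ?_⟩
  have hseg : ∀ s ∈ Set.Icc (0 : ℝ) 1, dist (p₀ + s • (p - p₀)) p₀ < δ := by
    intro s hs
    rw [dist_eq_norm, add_sub_cancel_left, norm_smul, Real.norm_of_nonneg hs.1]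
    rw [dist_eq_norm] at hp
    exact (mul_le_of_le_one_left (norm_nonneg _) hs.2).trans_lt hp
  have hφ : ∀ s ∈ Set.Icc (0 : ℝ) 1, HasDerivAt (fun s : ℝ => h (p₀ + s • (p - p₀)))
      (fderiv ℝ h (p₀ + s • (p - p₀)) (p - p₀)) s := by
    intro s hs
    refine (hball (hseg s hs)).1.hasFDerivAt.comp_hasDerivAt s ?_
    simpa using ((hasDerivAt_id s).smul_const (p - p₀)).const_add p₀
  have hmono : StrictMonoOn (fun s : ℝ => h (p₀ + s • (p - p₀))) (Set.Icc 0 1) := by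
    refine strictMonoOn_of_deriv_pos (convex_Icc 0 1)
      (fun s hs => (hφ s hs).continuousAt.continuousWithinAt) fun s hs => ?_
    rw [interior_Icc] at hs
    have hs' := Set.Ioo_subset_Icc_self hs
    rw [(hφ s hs').deriv]
    have h1 := hgradpos _ (hseg s hs')
      (by simpa [sub_eq_zero] using ⟨hs.1.ne', hne⟩)
    rw [add_sub_cancel_left, map_smul, smul_eq_mul] at h1
    exact pos_of_mul_pos_right h1 hs.1.le
  simpa using hmono (Set.left_mem_Icc.2 zero_le_one) (Set.right_mem_Icc.2 zero_le_one) one_pos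

theorem Matrix.PosDef.pos_of_bilin {n : Type*} [Fintype n] [DecidableEq n]
    {B : (n → ℝ) →L[ℝ] (n → ℝ) →L[ℝ] ℝ}
    (hB : (Matrix.of fun i j => B (Pi.single i 1) (Pi.single j 1)).PosDef)
    {v : n → ℝ} (hv : v ≠ 0) : 0 < B v v := by
  have h1 := hB.dotProduct_mulVec_pos hv
  have h2 : B v v = ∑ i, ∑ j, v i * (v j * B (Pi.single i 1) (Pi.single j 1)) := by
    have hv : v = ∑ i, v i • Pi.single i (1 : ℝ) := pi_eq_sum_univ' v
    calc B v v = B (∑ i, v i • Pi.single i (1 : ℝ)) (∑ j, v j • Pi.single j (1 : ℝ)) := by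
          rw [← hv]
      _ = _ := by
          simp only [map_sum, map_smul, FunLike.coe_sum, FunLike.coe_smul, Finset.sum_apply,
            Pi.smul_apply, smul_eq_mul, Finset.mul_sum]
          rw [Finset.sum_comm]
          exact Finset.sum_congr rfl fun i _ => Finset.sum_congr rfl fun j _ => by ring
  rw [h2]
  simpa [dotProduct, mulVec, Finset.mul_sum, mul_comm] using h1

/-- For a parameter-dependent twice continuously differentiable nonnegative
deviation functional `Δ(t, p)` vanishing at `t = 0`, with `Δ* > 0` and the threshold set
nonempty, if `ε > 0` is regular at `p₀` and `p₀` delivers a strong local maximum of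
`p ↦ τ(ε, p)` (vanishing gradient, negative definite Hessian), then at `T := τ(ε, p₀)`
the gradient of `p ↦ Δ(T, p)` at `p₀` vanishes, its Hessian is positive definite, and
`p₀` is a strict local minimiser of the finite-horizon criterion
`Δ_T(p) := max_{0 ≤ t ≤ T} Δ(t, p)`. -/
theorem strong_local_max_decoherence_time_implies_strong_local_min_deviation
    {r : ℕ} (Δ : ℝ → (Fin r → ℝ) → ℝ)
    (hC2 : ContDiff ℝ 2 (fun q : ℝ × (Fin r → ℝ) => Δ q.1 q.2))
    (hnonneg : ∀ t p, 0 ≤ Δ t p) (h0 : ∀ p, Δ 0 p = 0)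
    (Δstar : ℝ) (hΔstar : 0 < Δstar)
    (hne : ∀ (ε : ℝ) (p : Fin r → ℝ), 0 < ε → {t : ℝ | 0 ≤ t ∧ ε * Δstar ≤ Δ t p}.Nonempty)
    (τ : ℝ → (Fin r → ℝ) → ℝ)
    (hτ : ∀ (ε : ℝ) (p : Fin r → ℝ), τ ε p = sInf {t : ℝ | 0 ≤ t ∧ ε * Δstar ≤ Δ t p})
    (DeltaT : ℝ → (Fin r → ℝ) → ℝ)
    (hDeltaT : ∀ (T : ℝ) (p : Fin r → ℝ), DeltaT T p = sSup ((fun t => Δ t p) '' Set.Icc 0 T))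
    (ε : ℝ) (hε : 0 < ε) (p₀ : Fin r → ℝ)
    (T : ℝ) (hT : T = τ ε p₀)
    (hreg : 0 < deriv (fun t => Δ t p₀) T)
    -- `p₀` delivers a strong local maximum of `p ↦ τ(ε,p)`:
    (hgrad : fderiv ℝ (fun p => τ ε p) p₀ = 0)
    (hhess : (-(Matrix.of fun i j =>
        fderiv ℝ (fun p => fderiv ℝ (fun p' => τ ε p') p (Pi.single j 1)) p₀
          (Pi.single i 1))).PosDef) :
    fderiv ℝ (fun p => Δ T p) p₀ = 0 ∧
    (Matrix.of fun i j =>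
        fderiv ℝ (fun p => fderiv ℝ (fun p' => Δ T p') p (Pi.single j 1)) p₀
          (Pi.single i 1)).PosDef ∧
    ∃ U ∈ 𝓝 p₀, ∀ p ∈ U, p ≠ p₀ → DeltaT T p₀ < DeltaT T p := by
  have hF : Continuous fun q : ℝ × (Fin r → ℝ) => Δ q.1 q.2 := hC2.continuous
  have hc : 0 < ε * Δstar := mul_pos hε hΔstar
  have hspec := fun p => firstHit_spec (f := fun t => Δ t p)
    (hF.comp (Continuous.prodMk_left p))
    (by simpa [h0 p] using hc) (hne ε p hε)
  simp only [← hτ] at hspec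
  obtain ⟨hTpos, hTeq, hTlt⟩ := hspec p₀
  have hlim : ContinuousAt (τ ε) p₀ := by
    have := tendsto_firstHit hF (p₀ := p₀) (fun p => by simpa [h0 p] using hc)
      (fun p => hne ε p hε) (by rw [← hτ, ← hT]; exact hreg)
    simp only [← hτ] at this
    exact this
  have hlevel : ∀ᶠ p in 𝓝 p₀, Δ (τ ε p) p = ε * Δstar := .of_forall fun p => (hspec p).2.1
  have hτC2 : ContDiffAt ℝ 2 (τ ε) p₀ :=
    contDiffAt_of_implicit (by norm_num) hC2 hlim (hlevel.mono fun p hp => hp.trans hTeq.symm)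
      (by rw [← hT]; exact hreg.ne')
  obtain ⟨hgrad', hhess'⟩ := fderiv_levelSet_of_fderiv_eq_zero hC2 hτC2 hlevel hgrad
  rw [← hT] at hgrad' hhess' hTpos hTeq hTlt
  have hpd : (Matrix.of fun i j =>
        fderiv ℝ (fun p => fderiv ℝ (fun p' => Δ T p') p (Pi.single j 1)) p₀
          (Pi.single i 1)).PosDef := by
    convert hhess.smul hreg using 1
    ext i j
    simp [hhess']
  have hslice : ContDiff ℝ 2 fun p => Δ T p := hC2.comp (contDiff_prodMk_right T)
  have hd2 : DifferentiableAt ℝ (fderiv ℝ fun p => Δ T p) p₀ :=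
    (hslice.fderiv_right (m := 1) (by norm_num)).differentiable (by norm_num) p₀
  refine ⟨hgrad', hpd, _, eventually_lt_of_hessian_pos
    (.of_forall (hslice.differentiable (by norm_num))) hd2 hgrad' ?_, fun p hp hpne => ?_⟩
  · intro v hv
    refine Matrix.PosDef.pos_of_bilin ?_ hv
    convert hpd using 4 with i j
    rw [(hd2.hasFDerivAt.clm_apply (hasFDerivAt_const _ p₀)).fderiv]
    simp
  · have hcont : ∀ p, ContinuousOn (fun t => Δ t p) (Set.Icc 0 T) := fun p =>
      (hF.comp (Continuous.prodMk_left p)).continuousOn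
    rw [hDeltaT, hDeltaT]
    calc sSup ((fun t => Δ t p₀) '' Set.Icc 0 T) ≤ Δ T p₀ := by
          refine csSup_le ((Set.nonempty_Icc.2 hTpos.le).image _) ?_
          rintro _ ⟨t, ht, rfl⟩
          rcases ht.2.lt_or_eq with h | rfl
          · exact (hTlt t ht.1 h).le.trans hTeq.ge
          · exact le_rfl
      _ < Δ T p := hp hpne
      _ ≤ _ := le_csSup (isCompact_Icc.image_of_continuousOn (hcont p)).bddAbove
          ⟨T, Set.right_mem_Icc.2 hTpos.le, rfl⟩
end

section
/- Let Δ : ℝ → ℝ be a continuous nonnegative function with Δ(0) = 0, let Δ* > 0, suppose the set {t ≥ 0 : Δ(t) ≥ ε·Δ*} is nonempty for every ε > 0, and define τ(ε) := sInf {t ≥ 0 : Δ(t) ≥ ε·Δ*}. Then for every T > 0 such that the function t ↦ Δ(t)·exp(−t/T) is integrable on [0, ∞), the inequality (1/T)·∫₀^∞ Δ(t)·exp(−t/T) dt ≤ Δ*·∫₀^∞ exp(−τ(ε)/T) dε holds. -/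
open MeasureTheory Set

/-- The tail of the exponential kernel with mean `T`, as a Lebesgue integral. -/
theorem lintegral_exp_neg_div_Ioi {T : ℝ} (hT : 0 < T) (c : ℝ) :
    ∫⁻ t in Ioi c, ENNReal.ofReal (Real.exp (-t / T))
      = ENNReal.ofReal (T * Real.exp (-c / T)) := by
  have ha : -T⁻¹ < 0 := neg_neg_of_pos (inv_pos.2 hT)
  have heq : ∀ t : ℝ, -t / T = -T⁻¹ * t := fun t => by ring
  simp_rw [heq]
  rw [← ofReal_integral_eq_lintegral_ofReal (integrableOn_exp_mul_Ioi ha c)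
    (Filter.Eventually.of_forall fun _ => (Real.exp_pos _).le), integral_exp_mul_Ioi ha c]
  congr 1
  field_simp

/-- Layer-cake representation of a nonnegative number at scale `d`. -/
theorem ofReal_eq_mul_volume_Ioc {x d : ℝ} (hd : 0 < d) :
    ENNReal.ofReal x = ENNReal.ofReal d * volume (Ioc 0 (x / d)) := by
  rw [Real.volume_Ioc, sub_zero, ← ENNReal.ofReal_mul hd.le, mul_div_cancel₀ _ hd.ne']

/-- For a continuous nonnegative `Δ` with `Δ 0 = 0`, `Δ* > 0` and the
threshold set nonempty for every `ε > 0`, with decoherence time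
`τ ε := sInf {t ≥ 0 : Δ t ≥ ε·Δ*}`, for every effective time horizon `T > 0` for which
`t ↦ Δ(t)·exp(−t/T)` is integrable on `[0, ∞)` one has
`(1/T)·∫₀^∞ Δ(t)·exp(−t/T) dt ≤ Δ*·∫₀^∞ exp(−τ(ε)/T) dε`
(the integrals are understood as Lebesgue integrals of nonnegative functions, the
right-hand side possibly being infinite). -/
theorem discounted_deviation_le_decoherence_time_integral
    (Δ : ℝ → ℝ) (hcont : Continuous Δ) (hnonneg : ∀ t, 0 ≤ Δ t) (h0 : Δ 0 = 0)
    (Δstar : ℝ) (hΔstar : 0 < Δstar)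
    (hne : ∀ ε : ℝ, 0 < ε → {t : ℝ | 0 ≤ t ∧ ε * Δstar ≤ Δ t}.Nonempty)
    (τ : ℝ → ℝ) (hτ : ∀ ε : ℝ, τ ε = sInf {t : ℝ | 0 ≤ t ∧ ε * Δstar ≤ Δ t})
    (T : ℝ) (hT : 0 < T)
    (hint : IntegrableOn (fun t => Δ t * Real.exp (-t / T)) (Ici 0)) :
    ENNReal.ofReal (1 / T) *
        ∫⁻ t in Ioi (0 : ℝ), ENNReal.ofReal (Δ t * Real.exp (-t / T))
      ≤ ENNReal.ofReal Δstar *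
        ∫⁻ ε in Ioi (0 : ℝ), ENNReal.ofReal (Real.exp (-(τ ε) / T)) := by
  set e : ℝ → ENNReal := fun t => ENNReal.ofReal (Real.exp (-t / T))
  have hem : Measurable e := by fun_prop
  set S : Set (ℝ × ℝ) := {p : ℝ × ℝ | p.2 * Δstar ≤ Δ p.1} with hS
  have hSm : MeasurableSet S :=
    (isClosed_le (by fun_prop) (by fun_prop)).measurableSet
  have hfm : Measurable (S.indicator fun p => e p.1) :=
    (hem.comp measurable_fst).indicator hSm
  have hlayer : ∀ t, ENNReal.ofReal (Δ t * Real.exp (-t / T))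
      = ENNReal.ofReal Δstar *
        ∫⁻ ε in Ioi (0 : ℝ), S.indicator (fun p => e p.1) (t, ε) := by
    intro t
    have hind : ∀ ε, S.indicator (fun p => e p.1) (t, ε)
        = (Iic (Δ t / Δstar)).indicator (fun _ => e t) ε := by
      intro ε
      simp only [indicator_apply, hS, mem_ofPred_eq, mem_Iic, le_div_iff₀ hΔstar]
    simp_rw [hind]
    rw [lintegral_indicator_const measurableSet_Iic, Measure.restrict_apply measurableSet_Iic,
      inter_comm, Ioi_inter_Iic, ENNReal.ofReal_mul (hnonneg t),
      ofReal_eq_mul_volume_Ioc (x := Δ t) hΔstar]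
    ring
  have hslice : ∀ ε, ∫⁻ t in Ioi (0 : ℝ), S.indicator (fun p => e p.1) (t, ε)
      ≤ ENNReal.ofReal T * ENNReal.ofReal (Real.exp (-(τ ε) / T)) := by
    intro ε
    calc ∫⁻ t in Ioi (0 : ℝ), S.indicator (fun p => e p.1) (t, ε)
        ≤ ∫⁻ t in Ioi (0 : ℝ), (Ici (τ ε)).indicator e t := by
          refine setLIntegral_mono (hem.indicator measurableSet_Ici) fun t ht => ?_
          by_cases h : (t, ε) ∈ S
          · have hle : τ ε ≤ t := by
              rw [hτ]
              exact csInf_le ⟨0, fun _ hx => hx.1⟩ ⟨le_of_lt ht, h⟩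
            rw [indicator_of_mem h, indicator_of_mem (mem_Ici.2 hle)]
          · rw [indicator_of_notMem h]
            exact zero_le
      _ ≤ ∫⁻ t, (Ici (τ ε)).indicator e t := setLIntegral_le_lintegral _ _
      _ = ENNReal.ofReal T * ENNReal.ofReal (Real.exp (-(τ ε) / T)) := by
          rw [lintegral_indicator measurableSet_Ici, setLIntegral_congr Ioi_ae_eq_Ici.symm,
            lintegral_exp_neg_div_Ioi hT, ENNReal.ofReal_mul hT.le]
  calc ENNReal.ofReal (1 / T) *
        ∫⁻ t in Ioi (0 : ℝ), ENNReal.ofReal (Δ t * Real.exp (-t / T))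
      = ENNReal.ofReal (1 / T) * (ENNReal.ofReal Δstar * ∫⁻ ε in Ioi (0 : ℝ),
          ∫⁻ t in Ioi (0 : ℝ), S.indicator (fun p => e p.1) (t, ε)) := by
        simp_rw [hlayer]
        rw [lintegral_const_mul' _ _ ENNReal.ofReal_ne_top,
          lintegral_lintegral_swap (f := fun t ε => S.indicator (fun p => e p.1) (t, ε))
            hfm.aemeasurable]
    _ ≤ ENNReal.ofReal (1 / T) * (ENNReal.ofReal Δstar * ∫⁻ ε in Ioi (0 : ℝ),
          ENNReal.ofReal T * ENNReal.ofReal (Real.exp (-(τ ε) / T))) := by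
        gcongr with ε
        exact hslice ε
    _ = (ENNReal.ofReal (1 / T) * ENNReal.ofReal T) * (ENNReal.ofReal Δstar *
          ∫⁻ ε in Ioi (0 : ℝ), ENNReal.ofReal (Real.exp (-(τ ε) / T))) := by
        rw [lintegral_const_mul' _ _ ENNReal.ofReal_ne_top]
        ring
    _ = ENNReal.ofReal Δstar *
          ∫⁻ ε in Ioi (0 : ℝ), ENNReal.ofReal (Real.exp (-(τ ε) / T)) := by
        rw [← ENNReal.ofReal_mul (by positivity), one_div_mul_cancel hT.ne',
          ENNReal.ofReal_one, one_mul]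
end

section
/- Let Δ : ℝ → ℝ be a twice continuously differentiable nonnegative function with Δ(0) = 0, and suppose there are constants C > 0 and λ > 0 with |Δ″(t)| ≤ C·exp(λ·t) for all t ≥ 0. Set D := max(Δ′(0), C/λ). Then Δ(t) ≤ (D/λ)·(exp(λ·t) − 1) for all t ≥ 0; consequently, for any Δ* > 0 such that the set {t ≥ 0 : Δ(t) ≥ ε·Δ*} is nonempty for every ε > 0, the decoherence time τ(ε) := sInf {t ≥ 0 : Δ(t) ≥ ε·Δ*} admits the lower bound τ(ε) ≥ (1/λ)·ln(1 + λ·Δ*·ε/D) for every ε > 0. -/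
/-- A function that is nonnegative at `0` and has nonnegative derivative on `[0, ∞)` is
nonnegative on `[0, ∞)`. -/
theorem nonneg_of_hasDerivAt_nonneg {f f' : ℝ → ℝ} (hf : ∀ t, HasDerivAt f (f' t) t)
    (hf' : ∀ t, 0 ≤ t → 0 ≤ f' t) (h0 : 0 ≤ f 0) {t : ℝ} (ht : 0 ≤ t) : 0 ≤ f t := by
  have hmono : MonotoneOn f (Set.Ici 0) := by
    refine monotoneOn_of_deriv_nonneg (convex_Ici 0)
      (fun x _ => (hf x).continuousAt.continuousWithinAt)
      (fun x _ => (hf x).differentiableAt.differentiableWithinAt) fun x hx => ?_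
    rw [(hf x).deriv]
    exact hf' x (interior_subset hx)
  exact h0.trans (hmono Set.self_mem_Ici ht ht)

/-- A `C²` function vanishing at `0` whose second derivative is at most `C * exp (lam * t)` grows
at most like `D / lam * (exp (lam * t) - 1)`, once `D` bounds `deriv f 0` and `C / lam`. -/
theorem le_exp_sub_one_of_deriv_deriv_le {f : ℝ → ℝ} (hf : ContDiff ℝ 2 f) (h0 : f 0 = 0)
    {C lam D : ℝ} (hlam : 0 < lam)
    (hgrowth : ∀ t : ℝ, 0 ≤ t → deriv (deriv f) t ≤ C * Real.exp (lam * t))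
    (hD₀ : deriv f 0 ≤ D) (hDC : C / lam ≤ D) {t : ℝ} (ht : 0 ≤ t) :
    f t ≤ D / lam * (Real.exp (lam * t) - 1) := by
  have hf₁ : ∀ t, HasDerivAt f (deriv f t) t := fun t =>
    (hf.differentiable (by norm_num) t).hasDerivAt
  have hf₂ : ∀ t, HasDerivAt (deriv f) (deriv (deriv f) t) t := fun t =>
    (hf.differentiable_deriv_two t).hasDerivAt
  have hexp : ∀ t, HasDerivAt (fun s => Real.exp (lam * s)) (Real.exp (lam * t) * lam) t :=
    fun t => by simpa using ((hasDerivAt_id t).const_mul lam).exp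
  have hC : C ≤ D * lam := (div_le_iff₀ hlam).1 hDC
  have hderiv : ∀ t, 0 ≤ t → 0 ≤ D * Real.exp (lam * t) - deriv f t := fun t ht =>
    nonneg_of_hasDerivAt_nonneg (f := fun t => D * Real.exp (lam * t) - deriv f t)
      (fun t => ((hexp t).const_mul D).sub (hf₂ t))
      (fun t ht => by nlinarith [hgrowth t ht, Real.exp_pos (lam * t)]) (by simpa using hD₀) ht
  refine sub_nonneg.1 (nonneg_of_hasDerivAt_nonneg
    (f := fun t => D / lam * (Real.exp (lam * t) - 1) - f t)
    (fun t => (((hexp t).sub_const 1).const_mul (D / lam)).sub (hf₁ t)) (fun t ht => ?_)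
    (by simp [h0]) ht)
  convert hderiv t ht using 2
  field_simp

/-- For a twice continuously differentiable nonnegative `Δ` with `Δ 0 = 0`
and `|Δ″(t)| ≤ C·exp(λt)` for `t ≥ 0` (with `C, λ > 0`), setting
`D := max(Δ′(0), C/λ)` one has `Δ(t) ≤ (D/λ)·(exp(λt) − 1)` for all `t ≥ 0`; hence for
any `Δ* > 0` with the threshold set nonempty for every `ε > 0`, the decoherence time
`τ ε := sInf {t ≥ 0 : Δ t ≥ ε·Δ*}` satisfies
`τ(ε) ≥ (1/λ)·ln(1 + λ·Δ*·ε/D)` for every `ε > 0`. -/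
theorem decoherence_time_logarithmic_lower_bound
    (Δ : ℝ → ℝ) (hC2 : ContDiff ℝ 2 Δ) (hnonneg : ∀ t, 0 ≤ Δ t) (h0 : Δ 0 = 0)
    (C lam : ℝ) (hC : 0 < C) (hlam : 0 < lam)
    (hgrowth : ∀ t : ℝ, 0 ≤ t → |deriv (deriv Δ) t| ≤ C * Real.exp (lam * t))
    (D : ℝ) (hD : D = max (deriv Δ 0) (C / lam)) :
    (∀ t : ℝ, 0 ≤ t → Δ t ≤ D / lam * (Real.exp (lam * t) - 1)) ∧
    ∀ (Δstar : ℝ), 0 < Δstar →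
      (∀ ε : ℝ, 0 < ε → {t : ℝ | 0 ≤ t ∧ ε * Δstar ≤ Δ t}.Nonempty) →
      ∀ (τ : ℝ → ℝ),
        (∀ ε : ℝ, τ ε = sInf {t : ℝ | 0 ≤ t ∧ ε * Δstar ≤ Δ t}) →
        ∀ ε : ℝ, 0 < ε →
          1 / lam * Real.log (1 + lam * Δstar * ε / D) ≤ τ ε := by
  have hD₀ : deriv Δ 0 ≤ D := hD ▸ le_max_left _ _
  have hDC : C / lam ≤ D := hD ▸ le_max_right _ _
  have hDpos : 0 < D := (div_pos hC hlam).trans_le hDC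
  have hbound : ∀ t : ℝ, 0 ≤ t → Δ t ≤ D / lam * (Real.exp (lam * t) - 1) := fun t ht =>
    le_exp_sub_one_of_deriv_deriv_le hC2 h0 hlam
      (fun s hs => (le_abs_self _).trans (hgrowth s hs)) hD₀ hDC ht
  refine ⟨hbound, fun Δstar hstar hne τ hτ ε hε => ?_⟩
  rw [hτ]
  refine le_csInf (hne ε hε) ?_
  rintro t ⟨ht, hle⟩
  rw [one_div_mul_eq_div, div_le_iff₀ hlam, mul_comm t, Real.log_le_iff_le_exp (by positivity),
    ← le_sub_iff_add_le', div_le_iff₀ hDpos]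
  have h := hle.trans (hbound t ht)
  rw [div_mul_eq_mul_div, le_div_iff₀ hlam] at h
  linarith
end
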